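/- arXiv:1505.07123 — 7 statements merged into one kernel-verified Lean document; each statement's English description precedes it below -/
import Mathlib

section
/- Let (E, 𝓛, ℬ) be a weakly left resolving labelled space. Then the set T consisting of a zero element z together with all triples (α, A, β) ∈ 𝓛*(E) × ℬ × 𝓛*(E) with A ∈ ℬ_α ∩ ℬ_β, equipped with the product (α, A, β)(γ, B, δ) = (αγ', r(A, γ') ∩ B, δ) if γ = βγ', = (α, A ∩ r(B, β'), δβ') if β = γβ', and = z otherwise (with z absorbing), is a semigroup: the product is associative. -/
universe u v w

attribute [local instance] Classical.propDecidable

/-- Elements of the semigroups `T` and `S` associated with a labelled space: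
`none` plays the role of the zero element, and `some (α, A, β)` is a triple. -/
abbrev STrip (V : Type u) (L : Type w) := List L × Set V × List L

/-- A labelled graph: a directed graph `(V, Ed, rng, src)` together with a labelling
map `lbl` on edges, over the alphabet `L`. -/
structure LabelledGraph (V : Type u) (Ed : Type v) (L : Type w) where
  src : Ed → V
  rng : Ed → V
  lbl : Ed → L

namespace LabelledGraph

variable {V : Type u} {Ed : Type v} {L : Type w} (G : LabelledGraph V Ed L)

/-- A (finite) path: a list of edges with matching ranges and sources. -/
def IsPath (p : List Ed) : Prop := p.Chain' (fun e f => G.rng e = G.src f)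

/-- `α ∈ 𝓛*(E)`: the labels of finite paths, together with the empty word `[]`. -/
def IsWord (α : List L) : Prop := ∃ p : List Ed, G.IsPath p ∧ p.map G.lbl = α

/-- The relative range `r(A, α)`, with `r(A, ω) = A` for the empty word. -/
def relRange (A : Set V) : List L → Set V
  | [] => A
  | a :: w =>
      {v | ∃ (p : List Ed) (h : p ≠ []), G.IsPath p ∧ p.map G.lbl = a :: w ∧
        G.src (p.head h) ∈ A ∧ G.rng (p.getLast h) = v}

/-- `r(α) = r(E⁰, α)`. -/
def range (α : List L) : Set V := G.relRange Set.univ α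

/-- `ℬ_α = ℬ ∩ 𝒫(r(α))`. -/
def rFam (ℬ : Set (Set V)) (α : List L) : Set (Set V) := {A ∈ ℬ | A ⊆ G.range α}

/-- `ℬ` is accommodating for the labelled graph `G`: closed under relative ranges,
finite intersections and unions, and contains `r(α)` for every nonempty word `α`. -/
def Accommodating (ℬ : Set (Set V)) : Prop :=
  (∀ A ∈ ℬ, ∀ α : List L, G.IsWord α → G.relRange A α ∈ ℬ) ∧
  (∀ A ∈ ℬ, ∀ B ∈ ℬ, A ∩ B ∈ ℬ) ∧
  (∀ A ∈ ℬ, ∀ B ∈ ℬ, A ∪ B ∈ ℬ) ∧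
  (∀ α : List L, α ≠ [] → G.IsWord α → G.range α ∈ ℬ)

/-- The labelled space `(G, ℬ)` is weakly left resolving. -/
def WeaklyLeftResolving (ℬ : Set (Set V)) : Prop :=
  ∀ A ∈ ℬ, ∀ B ∈ ℬ, ∀ α : List L, α ≠ [] →
    G.relRange (A ∩ B) α = G.relRange A α ∩ G.relRange B α

/-- `ℬ` is closed under relative complements. -/
def ClosedUnderRelComp (ℬ : Set (Set V)) : Prop :=
  ∀ A ∈ ℬ, ∀ B ∈ ℬ, A \ B ∈ ℬ

/-- Membership in the semigroup `T`: either the zero `none`, or a triple `(α, A, β)`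
with `α, β ∈ 𝓛*(E)` and `A ∈ ℬ_α ∩ ℬ_β`. -/
def ValidT (ℬ : Set (Set V)) (t : Option (STrip V L)) : Prop :=
  ∀ x ∈ t, G.IsWord x.1 ∧ G.IsWord x.2.2 ∧ x.2.1 ∈ G.rFam ℬ x.1 ∧ x.2.1 ∈ G.rFam ℬ x.2.2

/-- Membership in the inverse semigroup `S`: as in `T`, but triples with empty middle
set are identified with the zero, so nonzero elements have nonempty middle set. -/
def ValidS (ℬ : Set (Set V)) (t : Option (STrip V L)) : Prop :=
  G.ValidT ℬ t ∧ ∀ x ∈ t, x.2.1 ≠ (∅ : Set V)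

/-- The product on `T`. -/
noncomputable def mulT : Option (STrip V L) → Option (STrip V L) → Option (STrip V L)
  | some (α, A, β), some (γ, B, δ) =>
      if β <+: γ then
        some (α ++ γ.drop β.length, G.relRange A (γ.drop β.length) ∩ B, δ)
      else if γ <+: β then
        some (α, A ∩ G.relRange B (β.drop γ.length), δ ++ β.drop γ.length)
      else none
  | _, _ => none

/-- The product on `S`: the product of `T`, with triples having empty middle set
collapsed to the zero element. -/
noncomputable def mulS (s t : Option (STrip V L)) : Option (STrip V L) :=
  match G.mulT s t with
  | none => none
  | some (α, A, β) => if A = (∅ : Set V) then none else some (α, A, β)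

/-- A nonzero idempotent `(α, A, α)` of `S`, represented as the pair `(α, A)`. -/
def ValidE (ℬ : Set (Set V)) (p : List L × Set V) : Prop :=
  G.IsWord p.1 ∧ p.2 ∈ G.rFam ℬ p.1 ∧ p.2 ≠ (∅ : Set V)

/-- The natural order on nonzero idempotents of `S`:
`(α, A, α) ≤ (β, B, β)` iff `α = βγ` and `A ⊆ r(B, γ)`. -/
def esLe (p q : List L × Set V) : Prop :=
  ∃ γ : List L, p.1 = q.1 ++ γ ∧ p.2 ⊆ G.relRange q.2 γ

/-- `p ∧ q ≠ 0` for nonzero idempotents `p`, `q` of `S`. -/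
def meetNeZero (p q : List L × Set V) : Prop :=
  (∃ γ : List L, q.1 = p.1 ++ γ ∧ (G.relRange p.2 γ ∩ q.2).Nonempty) ∨
  (∃ γ : List L, p.1 = q.1 ++ γ ∧ (p.2 ∩ G.relRange q.2 γ).Nonempty)

/-- A filter in the semilattice `E(S)`, identified with its set of (nonzero) elements:
nonempty, not containing `0`, upward closed and downward directed. -/
def IsFilterES (ℬ : Set (Set V)) (ξ : Set (List L × Set V)) : Prop :=
  ξ.Nonempty ∧ (∀ p ∈ ξ, G.ValidE ℬ p) ∧
  (∀ p ∈ ξ, ∀ q, G.ValidE ℬ q → G.esLe p q → q ∈ ξ) ∧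
  (∀ p ∈ ξ, ∀ q ∈ ξ, ∃ z ∈ ξ, G.esLe z p ∧ G.esLe z q)

/-- An ultrafilter in `E(S)`: a filter not properly contained in any filter. -/
def IsUltraES (ℬ : Set (Set V)) (ξ : Set (List L × Set V)) : Prop :=
  G.IsFilterES ℬ ξ ∧ ∀ η, G.IsFilterES ℬ η → ξ ⊆ η → ξ = η

/-- `Z` is a cover for `x` in `E(S)`: `Z ⊆ ↓x` and every nonzero `y ≤ x` meets some
element of `Z` nontrivially. -/
def IsCover (ℬ : Set (Set V)) (Z : Set (List L × Set V)) (x : List L × Set V) : Prop :=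
  (∀ z ∈ Z, G.ValidE ℬ z ∧ G.esLe z x) ∧
  ∀ y, G.ValidE ℬ y → G.esLe y x → ∃ z ∈ Z, G.meetNeZero z y

/-- A tight filter in `E(S)`: a filter meeting every finite cover of each of its
elements. -/
def IsTight (ℬ : Set (Set V)) (ξ : Set (List L × Set V)) : Prop :=
  G.IsFilterES ℬ ξ ∧
  ∀ x ∈ ξ, ∀ Z : Set (List L × Set V), Z.Finite → G.IsCover ℬ Z x → (Z ∩ ξ).Nonempty

/-- A filter in a family `𝒞` of subsets of `V` (e.g. `ℬ_α`), ordered by inclusion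
with least element `∅`. -/
def IsFilterIn (𝒞 F : Set (Set V)) : Prop :=
  F.Nonempty ∧ F ⊆ 𝒞 ∧ (∅ : Set V) ∉ F ∧
  (∀ A ∈ F, ∀ B ∈ 𝒞, A ⊆ B → B ∈ F) ∧
  (∀ A ∈ F, ∀ B ∈ F, ∃ C ∈ F, C ⊆ A ∧ C ⊆ B)

/-- An ultrafilter in a family `𝒞` of subsets of `V`. -/
def IsUltraIn (𝒞 F : Set (Set V)) : Prop :=
  IsFilterIn 𝒞 F ∧ ∀ F', IsFilterIn 𝒞 F' → F ⊆ F' → F = F'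

/-- `α ∈ 𝓛^∞(E)`: labels of infinite paths. -/
def IsInfWord (α : ℕ → L) : Prop :=
  ∃ p : ℕ → Ed, (∀ n, G.rng (p n) = G.src (p (n + 1))) ∧ ∀ n, G.lbl (p n) = α n

end LabelledGraph

/-- `α_{n+1, m}` (in the 1-indexed notation of the paper): the finite subword of the
infinite word `α` consisting of its letters at (0-indexed) positions `n, …, m-1`. -/
def LabelledGraph.seg {L : Type w} (α : ℕ → L) (n m : ℕ) : List L :=
  (List.range (m - n)).map fun i => α (n + i)

/-- `α_{1, n}`: the first `n` letters of the infinite word `α`. -/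
def LabelledGraph.prefixN {L : Type w} (α : ℕ → L) (n : ℕ) : List L :=
  LabelledGraph.seg α 0 n

namespace LabelledGraph

variable {V : Type u} {Ed : Type v} {L : Type w} (G : LabelledGraph V Ed L)

/-- A family `{F n}` as in the paper: `F n` is a filter in `ℬ_{α_{1,n}}` for `n > 0`,
and `F 0` is a filter in `ℬ` or empty. -/
def IsFam (ℬ : Set (Set V)) (α : ℕ → L) (F : ℕ → Set (Set V)) : Prop :=
  (∀ n, 0 < n → IsFilterIn (G.rFam ℬ (prefixN α n)) (F n)) ∧
  (F 0 = ∅ ∨ IsFilterIn (G.rFam ℬ (prefixN α 0)) (F 0))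

/-- An admissible family for the infinite word `α`. -/
def Admissible (ℬ : Set (Set V)) (α : ℕ → L) (F : ℕ → Set (Set V)) : Prop :=
  G.IsFam ℬ α F ∧
  ∀ n, F n ⊆ {A ∈ G.rFam ℬ (prefixN α n) | G.relRange A [α n] ∈ F (n + 1)}

/-- A complete family for the infinite word `α`. -/
def Complete (ℬ : Set (Set V)) (α : ℕ → L) (F : ℕ → Set (Set V)) : Prop :=
  G.IsFam ℬ α F ∧
  ∀ n, F n = {A ∈ G.rFam ℬ (prefixN α n) | G.relRange A [α n] ∈ F (n + 1)}

/-- The subset `⋃_{n} ⋃_{A ∈ F n} ↑(α_{1,n}, A, α_{1,n})` of `E(S)` determined by an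
infinite word `α` and a family `{F n}`. -/
def filtOfFam (ℬ : Set (Set V)) (α : ℕ → L) (F : ℕ → Set (Set V)) :
    Set (List L × Set V) :=
  {q | G.ValidE ℬ q ∧ ∃ n, ∃ A ∈ F n, G.esLe (prefixN α n, A) q}

/-- The prefix `α_{1,n}` of a finite-or-infinite word. -/
def wTake : List L ⊕ (ℕ → L) → ℕ → List L
  | Sum.inl w, n => w.take n
  | Sum.inr α, n => prefixN α n

/-- `n ≤ |α|` for a finite-or-infinite word `α`. -/
def wLe (n : ℕ) : List L ⊕ (ℕ → L) → Prop
  | Sum.inl w => n ≤ w.length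
  | Sum.inr _ => True

/-- The finite-or-infinite word is a labelled path (`𝓛*(E) ∪ 𝓛^∞(E)`). -/
def wGood : List L ⊕ (ℕ → L) → Prop
  | Sum.inl w => G.IsWord w
  | Sum.inr α => G.IsInfWord α

/-- `α` is a beginning of (or equal to) `β`, for finite-or-infinite words. -/
def wBeg : List L ⊕ (ℕ → L) → List L ⊕ (ℕ → L) → Prop
  | Sum.inl a, Sum.inl b => a <+: b
  | Sum.inl a, Sum.inr β => a = prefixN β a.length
  | Sum.inr α, Sum.inr β => α = β
  | Sum.inr _, Sum.inl _ => False

/-- The word associated with a filter `ξ` in `E(S)`: for a finite word `w`, `w`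
appears in `ξ` and has the largest length; for an infinite word `α`, the words of
elements of `ξ` are beginnings of `α`, of unbounded length. -/
def HasWord (ξ : Set (List L × Set V)) : List L ⊕ (ℕ → L) → Prop
  | Sum.inl w => (∃ A, (w, A) ∈ ξ) ∧ ∀ p ∈ ξ, p.1.length ≤ w.length
  | Sum.inr α => (∀ p ∈ ξ, ∃ n, p.1 = prefixN α n) ∧ ∀ n, ∃ p ∈ ξ, n ≤ p.1.length

end LabelledGraph
namespace LabelledGraph

theorem aux_range_nil {V : Type u} {Ed : Type v} {L : Type w}
    (G : LabelledGraph V Ed L) (A : Set V) : G.relRange A [] = A := rfl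

theorem aux_mem_range {V : Type u} {Ed : Type v} {L : Type w}
    (G : LabelledGraph V Ed L) (A : Set V) (α : List L) (hα : α ≠ []) (v : V) :
    v ∈ G.relRange A α ↔ ∃ (p : List Ed) (h : p ≠ []), G.IsPath p ∧ p.map G.lbl = α ∧
        G.src (p.head h) ∈ A ∧ G.rng (p.getLast h) = v := by
  cases α with
  | nil => exact absurd rfl hα
  | cons a w => exact Iff.rfl

theorem aux_range_append {V : Type u} {Ed : Type v} {L : Type w}
    (G : LabelledGraph V Ed L) (A : Set V) (α β : List L) :
    G.relRange A (α ++ β) = G.relRange (G.relRange A α) β := by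
  by_cases hα : α = []
  · subst hα; rfl
  by_cases hβ : β = []
  · subst hβ; rw [List.append_nil]; rfl
  ext v
  rw [aux_mem_range G _ _ (by simp [hα]), aux_mem_range G _ _ hβ]
  constructor
  · rintro ⟨p, hp, hpath, hl, hs, hr⟩
    obtain ⟨q, q', rfl, hq, hq'⟩ := List.map_eq_append_iff.1 hl
    have hqn : q ≠ [] := by rintro rfl; exact hα (by simpa using hq.symm)
    have hqn' : q' ≠ [] := by rintro rfl; exact hβ (by simpa using hq'.symm)
    have hc := List.isChain_append.1 hpath
    refine ⟨q', hqn', hc.2.1, hq', ?_, ?_⟩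
    · rw [aux_mem_range G _ _ hα]
      refine ⟨q, hqn, hc.1, hq, ?_, ?_⟩
      · rwa [List.head_append_of_ne_nil hqn] at hs
      · exact hc.2.2 _ (List.getLast_mem_getLast? hqn) _ (List.head_mem_head? hqn')
    · rwa [List.getLast_append_of_ne_nil _ hqn'] at hr
  · rintro ⟨q', hqn', hp', hq', hs, hr⟩
    rw [aux_mem_range G _ _ hα] at hs
    obtain ⟨q, hqn, hp, hq, hs, hm⟩ := hs
    refine ⟨q ++ q', by simp [hqn], ?_, by simp [hq, hq'], ?_, ?_⟩
    · refine List.isChain_append.2 ⟨hp, hp', ?_⟩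
      intro x hx y hy
      rw [List.getLast?_eq_some_getLast hqn] at hx
      rw [List.head?_eq_some_head hqn'] at hy
      cases hx; cases hy
      exact hm
    · rwa [List.head_append_of_ne_nil hqn]
    · rwa [List.getLast_append_of_ne_nil _ hqn']

theorem aux_word_right {V : Type u} {Ed : Type v} {L : Type w}
    (G : LabelledGraph V Ed L) (α β : List L) (h : G.IsWord (α ++ β)) : G.IsWord β := by
  obtain ⟨p, hp, hl⟩ := h
  obtain ⟨q, q', rfl, hq, hq'⟩ := List.map_eq_append_iff.1 hl
  exact ⟨q', (List.isChain_append.1 hp).2.1, hq'⟩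

theorem aux_mul_right {V : Type u} {Ed : Type v} {L : Type w}
    (G : LabelledGraph V Ed L) (α β γ δ : List L) (A B : Set V) :
    G.mulT (some (α, A, β)) (some (β ++ γ, B, δ)) =
      some (α ++ γ, G.relRange A γ ∩ B, δ) := by
  simp [mulT]

theorem aux_mul_left {V : Type u} {Ed : Type v} {L : Type w}
    (G : LabelledGraph V Ed L) (α β γ δ : List L) (A B : Set V) :
    G.mulT (some (α, A, γ ++ β)) (some (γ, B, δ)) =
      some (α, A ∩ G.relRange B β, δ ++ β) := by
  by_cases h : β = []
  · subst h
    simp [mulT, aux_range_nil]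
  · have : ¬ (γ ++ β <+: γ) := by
      intro hp
      have h1 := hp.length_le
      have h2 := List.length_pos_of_ne_nil h
      rw [List.length_append] at h1
      omega
    simp [mulT, this]

theorem aux_mul_none {V : Type u} {Ed : Type v} {L : Type w}
    (G : LabelledGraph V Ed L) (α β γ δ : List L) (A B : Set V)
    (h1 : ¬ β <+: γ) (h2 : ¬ γ <+: β) :
    G.mulT (some (α, A, β)) (some (γ, B, δ)) = none := by
  simp [mulT, h1, h2]

theorem aux_none_left {V : Type u} {Ed : Type v} {L : Type w}
    (G : LabelledGraph V Ed L) (x : Option (STrip V L)) : G.mulT none x = none := by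
  simp [mulT]

theorem aux_none_right {V : Type u} {Ed : Type v} {L : Type w}
    (G : LabelledGraph V Ed L) (x : Option (STrip V L)) : G.mulT x none = none := by
  simp [mulT]

theorem aux_incomp {L : Type w} (β γ x : List L) (h1 : ¬ β <+: γ) (h2 : ¬ γ <+: β) :
    ¬ β <+: γ ++ x ∧ ¬ γ ++ x <+: β :=
  ⟨fun h => (List.prefix_or_prefix_of_prefix h (List.prefix_append γ x)).elim h1 h2,
    fun h => h2 ((List.prefix_append γ x).trans h)⟩

/-- The product on the set `T` of triples (together with the zero
element) associated with a weakly left resolving labelled space is associative, so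
`T` is a semigroup with zero. -/
theorem mulT_assoc {V : Type u} {Ed : Type v} {L : Type w}
    [Nonempty V] [Countable V] [Nonempty Ed] [Countable Ed]
    (G : LabelledGraph V Ed L) (ℬ : Set (Set V))
    (hacc : G.Accommodating ℬ) (hwlr : G.WeaklyLeftResolving ℬ) :
    ∀ s t u : Option (STrip V L), G.ValidT ℬ s → G.ValidT ℬ t → G.ValidT ℬ u →
      G.mulT (G.mulT s t) u = G.mulT s (G.mulT t u) := by
  have hint : ∀ A ∈ ℬ, ∀ B ∈ ℬ, ∀ α : List L,
      G.relRange (A ∩ B) α = G.relRange A α ∩ G.relRange B α := by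
    intro A hA B hB α
    by_cases h : α = []
    · subst h; rfl
    · exact hwlr A hA B hB α h
  rintro (_ | ⟨α, A, β⟩) (_ | ⟨γ, B, δ⟩) (_ | ⟨ε, C, ζ⟩) hs ht hu
  all_goals try simp only [aux_none_left, aux_none_right]
  obtain ⟨-, hβ, ⟨hA, -⟩, -⟩ := hs _ rfl
  obtain ⟨hγ, hδ, ⟨hB, -⟩, -⟩ := ht _ rfl
  obtain ⟨hε, -, ⟨hC, -⟩, -⟩ := hu _ rfl
  dsimp only at hβ hA hγ hδ hB hε hC
  by_cases h1 : β <+: γ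
  · obtain ⟨γ', rfl⟩ := h1
    have hγ' := hacc.1 A hA γ' (aux_word_right G _ _ hγ)
    rw [aux_mul_right]
    by_cases h3 : δ <+: ε
    · obtain ⟨ε', rfl⟩ := h3
      rw [aux_mul_right, aux_mul_right, List.append_assoc β, aux_mul_right,
        hint _ hγ' _ hB, aux_range_append, List.append_assoc, Set.inter_assoc]
    · by_cases h4 : ε <+: δ
      · obtain ⟨δ', rfl⟩ := h4
        rw [aux_mul_left, aux_mul_left, aux_mul_right, Set.inter_assoc]
      · rw [aux_mul_none G _ _ _ _ _ _ h3 h4, aux_mul_none G _ _ _ _ _ _ h3 h4,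
          aux_none_right]
  · by_cases h2 : γ <+: β
    · obtain ⟨β', rfl⟩ := h2
      have hβ' := hacc.1 B hB β' (aux_word_right G _ _ hβ)
      rw [aux_mul_left]
      by_cases h3 : δ <+: ε
      · obtain ⟨ε', rfl⟩ := h3
        have hε' := hacc.1 B hB ε' (aux_word_right G _ _ hε)
        rw [aux_mul_right]
        by_cases h5 : β' <+: ε'
        · obtain ⟨x, rfl⟩ := h5
          rw [← List.append_assoc, ← List.append_assoc, aux_mul_right, aux_mul_right,
            hint _ hA _ hβ', aux_range_append, Set.inter_assoc]
        · by_cases h6 : ε' <+: β'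
          · obtain ⟨x, rfl⟩ := h6
            rw [← List.append_assoc, ← List.append_assoc, aux_mul_left, aux_mul_left,
              hint _ hε' _ hC, aux_range_append, Set.inter_assoc]
          · rw [aux_mul_none, aux_mul_none] <;>
              simpa only [List.prefix_append_right_inj]
      · by_cases h4 : ε <+: δ
        · obtain ⟨δ', rfl⟩ := h4
          have hδ' := hacc.1 C hC δ' (aux_word_right G _ _ hδ)
          rw [aux_mul_left, aux_mul_left, List.append_assoc ε, aux_mul_left,
            hint _ hB _ hδ', aux_range_append, List.append_assoc, Set.inter_assoc]
        · have h := aux_incomp ε δ β' h4 h3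
          rw [aux_mul_none G _ _ _ _ _ _ h3 h4, aux_none_right,
            aux_mul_none G _ _ _ _ _ _ h.2 h.1]
    · rw [aux_mul_none G _ _ _ _ _ _ h1 h2, aux_none_left]
      by_cases h3 : δ <+: ε
      · obtain ⟨ε', rfl⟩ := h3
        have h := aux_incomp β γ ε' h1 h2
        rw [aux_mul_right, aux_mul_none G _ _ _ _ _ _ h.1 h.2]
      · by_cases h4 : ε <+: δ
        · obtain ⟨δ', rfl⟩ := h4
          rw [aux_mul_left, aux_mul_none G _ _ _ _ _ _ h1 h2]
        · rw [aux_mul_none G _ _ _ _ _ _ h3 h4, aux_none_right]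
end LabelledGraph
end

section
/- Let (E, 𝓛, ℬ) be a weakly left resolving labelled space and let S be the quotient of the semigroup T obtained by identifying all elements (α, ∅, β) with the zero element, denoted 0. Then S is an inverse semigroup with zero: for every nonzero s = (α, A, β) ∈ S there is a unique t ∈ S with sts = s and tst = t, namely t = (β, A, α). -/
universe u v w

attribute [local instance] Classical.propDecidable

namespace LabelledGraph

theorem mulS_some_inv {V : Type u} {Ed : Type v} {L : Type w}
    (G : LabelledGraph V Ed L) (α β γ δ μ ν : List L) (A B C : Set V)
    (h : G.mulS (some (α, A, β)) (some (γ, B, δ)) = some (μ, C, ν)) :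
    (∃ γ', γ = β ++ γ' ∧ μ = α ++ γ' ∧ C = G.relRange A γ' ∩ B ∧ ν = δ) ∨
    (∃ β', β = γ ++ β' ∧ μ = α ∧ C = A ∩ G.relRange B β' ∧ ν = δ ++ β') := by
  unfold mulS mulT at h
  by_cases h1 : β <+: γ
  · obtain ⟨γ', rfl⟩ := h1
    left
    refine ⟨γ', rfl, ?_⟩
    simp only [List.prefix_append, if_true, List.drop_left] at h
    split_ifs at h
    simp only [Option.some.injEq, Prod.mk.injEq] at h
    exact ⟨h.1.symm, h.2.1.symm, h.2.2.symm⟩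
  · by_cases h2 : γ <+: β
    · obtain ⟨β', rfl⟩ := h2
      right
      refine ⟨β', rfl, ?_⟩
      simp only [h1, List.prefix_append, if_true, if_false, List.drop_left] at h
      split_ifs at h
      simp only [Option.some.injEq, Prod.mk.injEq] at h
      exact ⟨h.1.symm, h.2.1.symm, h.2.2.symm⟩
    · simp [h1, h2] at h

theorem mulS_same {V : Type u} {Ed : Type v} {L : Type w}
    (G : LabelledGraph V Ed L) (α β δ : List L) (A : Set V) (hA : A ≠ ∅) :
    G.mulS (some (α, A, β)) (some (β, A, δ)) = some (α, A, δ) := by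
  simp [mulS, mulT, relRange, hA]

theorem mulS_none_right {V : Type u} {Ed : Type v} {L : Type w}
    (G : LabelledGraph V Ed L) (s : Option (STrip V L)) : G.mulS s none = none := by
  rcases s with _ | ⟨α, A, β⟩ <;> simp [mulS, mulT]

theorem mulS_none_left {V : Type u} {Ed : Type v} {L : Type w}
    (G : LabelledGraph V Ed L) (s : Option (STrip V L)) : G.mulS none s = none := by
  simp [mulS, mulT]

/-- From `s t s = s`: the words of `t` are beginnings of those of `s`. -/
theorem sts_inv {V : Type u} {Ed : Type v} {L : Type w}
    (G : LabelledGraph V Ed L) (α β γ δ : List L) (A B : Set V)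
    (h : G.mulS (G.mulS (some (α, A, β)) (some (γ, B, δ))) (some (α, A, β))
      = some (α, A, β)) :
    ∃ η, β = γ ++ η ∧ α = δ ++ η ∧ A ⊆ G.relRange B η := by
  rcases hx : G.mulS (some (α, A, β)) (some (γ, B, δ)) with _ | ⟨μ, C, ν⟩
  · rw [hx, mulS_none_left] at h
    cases h
  rw [hx] at h
  have hC : A ⊆ C := by
    rcases mulS_some_inv G _ _ _ _ _ _ _ _ _ h with
      ⟨θ, h1, h2, h3, h4⟩ | ⟨θ, h1, h2, h3, h4⟩
    · have : θ = [] := by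
        have e1 := congrArg List.length h2
        rcases mulS_some_inv G _ _ _ _ _ _ _ _ _ hx with
          ⟨κ, k1, k2, k3, k4⟩ | ⟨κ, k1, k2, k3, k4⟩
        · subst k2
          simp only [List.length_append] at e1
          exact List.length_eq_zero_iff.1 (by omega)
        · subst k2
          simpa using h2
      subst this
      intro x hx'
      rw [h3] at hx'
      exact hx'.1
    · intro x hx'
      rw [h3] at hx'
      exact hx'.1
  rcases mulS_some_inv G _ _ _ _ _ _ _ _ _ hx with
      ⟨κ, k1, k2, k3, k4⟩ | ⟨κ, k1, k2, k3, k4⟩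
  · subst k1 k2 k3 k4
    have hk : κ = [] := by
      rcases mulS_some_inv G _ _ _ _ _ _ _ _ _ h with
        ⟨θ, h1, h2, h3, h4⟩ | ⟨θ, h1, h2, h3, h4⟩
      · have e1 := congrArg List.length h2
        simp only [List.length_append] at e1
        exact List.length_eq_zero_iff.1 (by omega)
      · simpa using h2
    subst hk
    refine ⟨[], by simp, ?_, fun x hx' => (hC hx').2⟩
    rcases mulS_some_inv G _ _ _ _ _ _ _ _ _ h with
      ⟨θ, h1, h2, h3, h4⟩ | ⟨θ, h1, h2, h3, h4⟩
    · have : θ = [] := by simpa using h2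
      simpa [this] using h1
    · have : θ = [] := by simpa using h4
      simpa [this] using h1.symm
  · subst k3
    refine ⟨κ, k1, ?_, fun x hx' => (hC hx').2⟩
    rw [← k4]
    rcases mulS_some_inv G _ _ _ _ _ _ _ _ _ h with
      ⟨θ, h1, h2, h3, h4⟩ | ⟨θ, h1, h2, h3, h4⟩
    · have : θ = [] := by
        rw [k2] at h2
        simpa using h2
      simpa [this] using h1
    · have : θ = [] := by simpa using h4
      simpa [this] using h1.symm

/-- The quotient semigroup `S` of `T` (obtained by collapsing all
triples with empty middle set to the zero element) is an inverse semigroup with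
zero: every nonzero `s = (α, A, β)` has a unique generalized inverse `t` with
`s t s = s` and `t s t = t`, namely `t = (β, A, α)`. -/
theorem mulS_inverse {V : Type u} {Ed : Type v} {L : Type w}
    [Nonempty V] [Countable V] [Nonempty Ed] [Countable Ed]
    (G : LabelledGraph V Ed L) (ℬ : Set (Set V))
    (hacc : G.Accommodating ℬ) (hwlr : G.WeaklyLeftResolving ℬ) :
    ∀ (α β : List L) (A : Set V), G.IsWord α → G.IsWord β →
      A ∈ G.rFam ℬ α → A ∈ G.rFam ℬ β → A ≠ (∅ : Set V) →
      (G.mulS (G.mulS (some (α, A, β)) (some (β, A, α))) (some (α, A, β))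
          = some (α, A, β) ∧
        G.mulS (G.mulS (some (β, A, α)) (some (α, A, β))) (some (β, A, α))
          = some (β, A, α)) ∧
      ∀ t : Option (STrip V L), G.ValidS ℬ t →
        G.mulS (G.mulS (some (α, A, β)) t) (some (α, A, β)) = some (α, A, β) →
        G.mulS (G.mulS t (some (α, A, β))) t = t →
        t = some (β, A, α) := by
  intro α β A _ _ _ _ hA
  refine ⟨⟨?_, ?_⟩, ?_⟩
  · rw [mulS_same G _ _ _ _ hA, mulS_same G _ _ _ _ hA]
  · rw [mulS_same G _ _ _ _ hA, mulS_same G _ _ _ _ hA]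
  · intro t _ h1 h2
    rcases t with _ | ⟨γ, B, δ⟩
    · rw [mulS_none_right, mulS_none_left] at h1
      cases h1
    · obtain ⟨η, e1, e2, e3⟩ := sts_inv G _ _ _ _ _ _ h1
      obtain ⟨θ, f1, f2, f3⟩ := sts_inv G _ _ _ _ _ _ h2
      have hη : η = [] := by
        have l1 := congrArg List.length e1
        have l2 := congrArg List.length f2
        simp at l1 l2
        exact List.length_eq_zero_iff.1 (by omega)
      have hθ : θ = [] := by
        have l1 := congrArg List.length e1
        have l2 := congrArg List.length f2
        simp at l1 l2
        exact List.length_eq_zero_iff.1 (by omega)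
      subst hη hθ
      have hAB : A = B := Set.Subset.antisymm e3 f3
      simp at e1 e2
      rw [e1, e2, hAB]

end LabelledGraph
end

section
/- Let (E, 𝓛, ℬ) be a weakly left resolving labelled space and S its associated inverse semigroup, with natural order p ≤ q iff pq = p on the idempotent semilattice E(S). For nonzero idempotents p = (α, A, α) and q = (β, B, β) in E(S), one has p ≤ q if and only if β is a beginning of α, say α = βα', and A ⊆ r(B, α'). -/
universe u v w

attribute [local instance] Classical.propDecidable

namespace LabelledGraph

/-- For nonzero idempotents `p = (α, A, α)` and `q = (β, B, β)` of
`S`, one has `p ≤ q` (i.e. `pq = p`) iff `β` is a beginning of `α`, say `α = βα'`,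
and `A ⊆ r(B, α')`. -/
theorem idempotent_order {V : Type u} {Ed : Type v} {L : Type w}
    [Nonempty V] [Countable V] [Nonempty Ed] [Countable Ed]
    (G : LabelledGraph V Ed L) (ℬ : Set (Set V))
    (hacc : G.Accommodating ℬ) (hwlr : G.WeaklyLeftResolving ℬ) :
    ∀ (α β : List L) (A B : Set V),
      G.IsWord α → A ∈ G.rFam ℬ α → A ≠ (∅ : Set V) →
      G.IsWord β → B ∈ G.rFam ℬ β → B ≠ (∅ : Set V) →
      (G.mulS (some (α, A, α)) (some (β, B, β)) = some (α, A, α) ↔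
        ∃ γ : List L, α = β ++ γ ∧ A ⊆ G.relRange B γ) := by
  intro α β A B _ _ hA _ _ _
  constructor
  · intro h
    by_cases h1 : α <+: β
    · obtain ⟨δ, rfl⟩ := h1
      by_cases he : G.relRange A δ ∩ B = ∅
      · simp [mulS, mulT, he] at h
      · simp [mulS, mulT, he] at h
        obtain ⟨rfl, h2⟩ := h
        refine ⟨[], by simp, ?_⟩
        simpa [relRange] using h2
    · by_cases h2 : β <+: α
      · obtain ⟨γ, rfl⟩ := h2
        refine ⟨γ, rfl, ?_⟩
        by_cases he : A ∩ G.relRange B γ = ∅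
        · simp [mulS, mulT, h1, he] at h
        · simp only [mulS, mulT, h1, if_false, List.prefix_append, if_true, List.drop_left, he] at h
          simpa using h
      · simp [mulS, mulT, h1, h2] at h
  · rintro ⟨γ, rfl, hs⟩
    rcases γ with _ | ⟨a, w⟩
    · have : A ∩ B = A := Set.inter_eq_left.2 hs
      simp [mulS, mulT, relRange, this, hA]
    · have h1 : ¬ (β ++ a :: w <+: β) := by
        intro h
        have := h.length_le
        simp at this
      have h2 := Set.inter_eq_left.2 hs
      simp only [mulS, mulT, h1, if_false, List.prefix_append, if_true, List.drop_left, h2, hA]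


end LabelledGraph
end

section
/- Let (E, 𝓛, ℬ) be a weakly left resolving labelled space with associated inverse semigroup S. Let α ∈ 𝓛*(E) and let F be a filter in ℬ_α. Then ξ = ⋃_{A ∈ F} ↑(α, A, α) = {(α_{1,i}, A, α_{1,i}) ∈ E(S) : 0 ≤ i ≤ |α| and r(A, α_{i+1,|α|}) ∈ F} is a filter in E(S). -/
universe u v w

attribute [local instance] Classical.propDecidable

namespace LabelledGraph

theorem aux_relRange_mono {V : Type u} {Ed : Type v} {L : Type w} (G : LabelledGraph V Ed L)
    {A B : Set V} (h : A ⊆ B) (γ : List L) : G.relRange A γ ⊆ G.relRange B γ := by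
  cases γ with
  | nil => exact h
  | cons a w =>
    rintro v ⟨p, hp, h1, h2, h3, h4⟩
    exact ⟨p, hp, h1, h2, h h3, h4⟩

theorem aux_mem_relRange {V : Type u} {Ed : Type v} {L : Type w} (G : LabelledGraph V Ed L)
    {A : Set V} {γ : List L} (hγ : γ ≠ []) {v : V} : v ∈ G.relRange A γ ↔
      ∃ (p : List Ed) (h : p ≠ []), G.IsPath p ∧ p.map G.lbl = γ ∧
        G.src (p.head h) ∈ A ∧ G.rng (p.getLast h) = v := by
  cases γ with
  | nil => exact absurd rfl hγ
  | cons a w => exact Iff.rfl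

theorem aux_relRange_append {V : Type u} {Ed : Type v} {L : Type w} (G : LabelledGraph V Ed L)
    (A : Set V) (β γ : List L) : G.relRange (G.relRange A β) γ ⊆ G.relRange A (β ++ γ) := by
  by_cases hβ : β = []
  · subst hβ; exact subset_rfl
  by_cases hγ : γ = []
  · subst hγ; rw [List.append_nil]; exact subset_rfl
  intro v hv
  rw [aux_mem_relRange G hγ] at hv
  obtain ⟨p, hp, h1, h2, h3, h4⟩ := hv
  rw [aux_mem_relRange G hβ] at h3
  obtain ⟨q, hq, k1, k2, k3, k4⟩ := h3
  rw [aux_mem_relRange G (by simp [hβ])]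
  refine ⟨q ++ p, by simp [hq], ?_, by simp [h2, k2], ?_, ?_⟩
  · refine List.isChain_append.2 ⟨k1, h1, ?_⟩
    intro x hx y hy
    rw [List.getLast?_eq_some_getLast hq] at hx
    rw [List.head?_eq_some_head hp] at hy
    simp only [Option.mem_def, Option.some.injEq] at hx hy
    rw [← hx, ← hy, k4]
  · rw [List.head_append_of_ne_nil hq]; exact k3
  · rw [List.getLast_append_of_ne_nil _ hp]; exact h4

theorem aux_isWord_suffix {V : Type u} {Ed : Type v} {L : Type w} (G : LabelledGraph V Ed L)
    {β γ : List L} (h : G.IsWord (β ++ γ)) : G.IsWord γ := by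
  obtain ⟨p, hp, hm⟩ := h
  refine ⟨p.drop β.length, List.IsChain.drop hp _, ?_⟩
  rw [List.map_drop, hm]; simp

/-- For a word `α ∈ 𝓛*(E)` and a filter `F` in `ℬ_α`, the set
`ξ = ⋃_{A ∈ F} ↑(α, A, α)`, which equals
`{(α_{1,i}, A, α_{1,i}) ∈ E(S) : 0 ≤ i ≤ |α|, r(A, α_{i+1,|α|}) ∈ F}`,
is a filter in `E(S)`. -/
theorem filter_from_word_and_filter {V : Type u} {Ed : Type v} {L : Type w}
    [Nonempty V] [Countable V] [Nonempty Ed] [Countable Ed]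
    (G : LabelledGraph V Ed L) (ℬ : Set (Set V))
    (hacc : G.Accommodating ℬ) (hwlr : G.WeaklyLeftResolving ℬ)
    (α : List L) (hα : G.IsWord α)
    (F : Set (Set V)) (hF : IsFilterIn (G.rFam ℬ α) F) :
    ({q : List L × Set V | G.ValidE ℬ q ∧ ∃ A ∈ F, G.esLe (α, A) q} =
      {q : List L × Set V | G.ValidE ℬ q ∧
        ∃ i, i ≤ α.length ∧ q.1 = α.take i ∧ G.relRange q.2 (α.drop i) ∈ F}) ∧
    G.IsFilterES ℬ {q : List L × Set V | G.ValidE ℬ q ∧ ∃ A ∈ F, G.esLe (α, A) q} := by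
  have key : ∀ q : List L × Set V, G.ValidE ℬ q → ∀ γ : List L, α = q.1 ++ γ →
      ∀ A ∈ F, A ⊆ G.relRange q.2 γ → G.relRange q.2 γ ∈ F := by
    intro q hq γ hγ A hA hsub
    refine hF.2.2.2.1 A hA _ ⟨?_, ?_⟩ hsub
    · exact hacc.1 _ hq.2.1.1 γ (aux_isWord_suffix G (hγ ▸ hα))
    · rw [hγ]
      exact (aux_relRange_mono G hq.2.1.2 γ).trans (aux_relRange_append G _ _ _)
  have hval : ∀ A ∈ F, G.ValidE ℬ (α, A) := fun A hA =>
    ⟨hα, hF.2.1 hA, fun h => hF.2.2.1 (by have h' : A = ∅ := h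
                                          exact h' ▸ hA)⟩
  refine ⟨?_, ?_, fun p hp => hp.1, ?_, ?_⟩
  · ext q
    constructor
    · rintro ⟨hq, A, hA, γ, hγ, hsub⟩
      have hγ' : α = q.1 ++ γ := hγ
      refine ⟨hq, q.1.length, by simp [hγ'], by simp [hγ'], ?_⟩
      have hd : α.drop q.1.length = γ := by simp [hγ']
      rw [hd]
      exact key q hq γ hγ' A hA hsub
    · rintro ⟨hq, i, hi, h1, h2⟩
      exact ⟨hq, _, h2, α.drop i, by simp [h1], subset_rfl⟩
  · obtain ⟨A, hA⟩ := hF.1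
    exact ⟨(α, A), hval A hA, A, hA, [], by simp, subset_rfl⟩
  · rintro p ⟨hp, A, hA, γ, hγ, hsub⟩ q hq ⟨δ, hδ, hsub'⟩
    refine ⟨hq, A, hA, δ ++ γ, ?_, ?_⟩
    · rw [hγ, hδ, List.append_assoc]
    · exact hsub.trans ((aux_relRange_mono G hsub' γ).trans (aux_relRange_append G _ _ _))
  · rintro p ⟨hp, A, hA, γ, hγ, hsub⟩ q ⟨hq, B, hB, δ, hδ, hsub'⟩
    obtain ⟨C, hC, hCA, hCB⟩ := hF.2.2.2.2 A hA B hB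
    exact ⟨(α, C), ⟨hval C hC, C, hC, [], by simp, subset_rfl⟩,
      ⟨γ, hγ, hCA.trans hsub⟩, ⟨δ, hδ, hCB.trans hsub'⟩⟩

end LabelledGraph
end

section
/- Let (E, 𝓛, ℬ) be a weakly left resolving labelled space with associated inverse semigroup S. Let ξ be a filter in E(S) and suppose there exists α ∈ 𝓛*(E) with (α, A, α) ∈ ξ for some A ∈ ℬ_α such that α has the largest length among all words β with (β, B, β) ∈ ξ for some B ∈ ℬ_β. Then F = {A ∈ ℬ : (α, A, α) ∈ ξ} is a filter in ℬ_α and ξ = ⋃_{A ∈ F} ↑(α, A, α). -/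
universe u v w

attribute [local instance] Classical.propDecidable

namespace LabelledGraph

/-- If `ξ` is a filter in `E(S)` having an element `(α, A, α)` whose
word `α` has the largest length among the words appearing in `ξ`, then
`F = {A ∈ ℬ : (α, A, α) ∈ ξ}` is a filter in `ℬ_α` and `ξ = ⋃_{A ∈ F} ↑(α, A, α)`. -/
theorem word_and_filter_from_filter {V : Type u} {Ed : Type v} {L : Type w}
    [Nonempty V] [Countable V] [Nonempty Ed] [Countable Ed]
    (G : LabelledGraph V Ed L) (ℬ : Set (Set V))
    (hacc : G.Accommodating ℬ) (hwlr : G.WeaklyLeftResolving ℬ)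
    (ξ : Set (List L × Set V)) (hξ : G.IsFilterES ℬ ξ)
    (α : List L) (A₀ : Set V) (hmem : (α, A₀) ∈ ξ)
    (hmax : ∀ p ∈ ξ, p.1.length ≤ α.length) :
    IsFilterIn (G.rFam ℬ α) {A : Set V | (α, A) ∈ ξ} ∧
    ξ = {q : List L × Set V | G.ValidE ℬ q ∧
      ∃ A ∈ {A : Set V | (α, A) ∈ ξ}, G.esLe (α, A) q} := by
  obtain ⟨hne, hval, hup, hdir⟩ := hξ
  have key : ∀ p ∈ ξ, ∃ C, (α, C) ∈ ξ ∧ C ⊆ A₀ ∧ G.esLe (α, C) p := by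
    intro p hp
    obtain ⟨⟨w, C⟩, hz, ⟨γ, h1, h2⟩, hzp⟩ := hdir _ hmem p hp
    have hl := hmax _ hz
    simp only at h1 h2 hl
    have hγ : γ = [] := by
      rw [h1, List.length_append] at hl
      exact List.length_eq_zero_iff.mp (by omega)
    subst hγ
    simp only [List.append_nil] at h1
    subst h1
    exact ⟨C, hz, h2, hzp⟩
  have sub_of : ∀ C A : Set V, G.esLe (α, C) (α, A) → C ⊆ A := by
    rintro C A ⟨γ, h1, h2⟩
    simp only [List.self_eq_append_right] at h1
    subst h1
    exact h2
  have le_of : ∀ C A : Set V, C ⊆ A → G.esLe (α, C) (α, A) := by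
    intro C A h
    exact ⟨[], by simp, h⟩
  refine ⟨⟨⟨A₀, hmem⟩, ?_, ?_, ?_, ?_⟩, ?_⟩
  · intro A hA
    exact (hval _ hA).2.1
  · intro h
    exact (hval _ h).2.2 rfl
  · intro A hA B hB hAB
    refine hup _ hA _ ⟨(hval _ hA).1, hB, ?_⟩ (le_of _ _ hAB)
    intro hBe
    simp only at hBe
    subst hBe
    exact (hval _ hA).2.2 (Set.subset_empty_iff.mp hAB)
  · intro A hA B hB
    obtain ⟨⟨w, C⟩, hz, hzA, hzB⟩ := hdir _ hA _ hB
    obtain ⟨γ, h1, h2⟩ := hzA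
    have hl := hmax _ hz
    simp only at h1 h2 hl
    have hγ : γ = [] := by
      rw [h1, List.length_append] at hl
      exact List.length_eq_zero_iff.mp (by omega)
    subst hγ
    simp only [List.append_nil] at h1
    subst h1
    exact ⟨C, hz, h2, sub_of _ _ hzB⟩
  · ext q
    constructor
    · intro hq
      obtain ⟨C, hC, _, hle⟩ := key q hq
      exact ⟨hval _ hq, C, hC, hle⟩
    · rintro ⟨hv, A, hA, hle⟩
      exact hup _ hA _ hv hle

end LabelledGraph
end

section
/- Let (E, 𝓛, ℬ) be a weakly left resolving labelled space with associated inverse semigroup S, let α ∈ 𝓛^∞(E), and let {F_n}_{n≥0} be an admissible family for α. For each n ≥ 0 define F̄_n = {A ∈ ℬ_{α_{1,n}} : r(A, α_{n+1,m}) ∈ F_m for some m ≥ n}. Then: (i) F_n ⊆ F̄_n for all n ≥ 0; (ii) {F̄_n}_{n≥0} is a complete family for α; (iii) the pairs (α, {F_n}_{n≥0}) and (α, {F̄_n}_{n≥0}) generate the same filter ⋃_{n≥0} ⋃_{A ∈ F_n} ↑(α_{1,n}, A, α_{1,n}) = ⋃_{n≥0} ⋃_{A ∈ F̄_n} ↑(α_{1,n},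 A, α_{1,n}) in E(S). -/
universe u v w

attribute [local instance] Classical.propDecidable

namespace LabelledGraph

/-- One-step range. -/
def stepR {V : Type u} {Ed : Type v} {L : Type w} (G : LabelledGraph V Ed L)
    (A : Set V) (a : L) : Set V := {x | ∃ e, G.lbl e = a ∧ G.src e ∈ A ∧ G.rng e = x}

theorem relRange_cons {V : Type u} {Ed : Type v} {L : Type w} (G : LabelledGraph V Ed L)
    (A : Set V) (a : L) (w : List L) :
    G.relRange A (a :: w) = G.relRange (G.stepR A a) w := by
  ext x
  cases w with
  | nil =>
    constructor
    · rintro ⟨p, hp, hpath, hmap, hs, hr⟩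
      match p, hp with
      | [e], _ => exact ⟨e, by simpa using hmap, hs, hr⟩
      | e :: f :: t, _ => simp at hmap
    · rintro ⟨e, he, hs, hr⟩
      exact ⟨[e], by simp, by simp [IsPath, List.Chain'], by simp [he], hs, hr⟩
  | cons b w =>
    constructor
    · rintro ⟨p, hp, hpath, hmap, hs, hr⟩
      match p, hp with
      | [e], _ => simp at hmap
      | e :: f :: t, _ =>
        simp only [IsPath, List.isChain_cons_cons, List.Chain'] at hpath
        simp only [List.map_cons, List.cons.injEq] at hmap
        refine ⟨f :: t, by simp, hpath.2, by simp [hmap], ⟨e, hmap.1, hs, hpath.1⟩, ?_⟩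
        simpa using hr
    · rintro ⟨p, hp, hpath, hmap, ⟨e, he, hs, hr'⟩, hr⟩
      match p, hp with
      | f :: t, _ =>
        refine ⟨e :: f :: t, by simp, ?_, ?_, hs, ?_⟩
        · simp only [IsPath, List.isChain_cons_cons, List.Chain']
          exact ⟨hr', hpath⟩
        · rw [List.map_cons, hmap, he]
        · simpa using hr

theorem relRange_append {V : Type u} {Ed : Type v} {L : Type w} (G : LabelledGraph V Ed L)
    (A : Set V) (u v : List L) :
    G.relRange A (u ++ v) = G.relRange (G.relRange A u) v := by
  induction u generalizing A with
  | nil => rfl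
  | cons a u ih => rw [List.cons_append, relRange_cons, ih, relRange_cons G A a u]

theorem relRange_mono {V : Type u} {Ed : Type v} {L : Type w} (G : LabelledGraph V Ed L)
    {A B : Set V} (h : A ⊆ B) (u : List L) : G.relRange A u ⊆ G.relRange B u := by
  induction u generalizing A B with
  | nil => exact h
  | cons a u ih =>
    rw [relRange_cons, relRange_cons]
    apply ih
    rintro x ⟨e, he, hs, hr⟩
    exact ⟨e, he, h hs, hr⟩

theorem relRange_empty {V : Type u} {Ed : Type v} {L : Type w} (G : LabelledGraph V Ed L)
    (u : List L) : G.relRange ∅ u = ∅ := by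
  induction u with
  | nil => rfl
  | cons a u ih =>
    rw [relRange_cons]
    have : G.stepR ∅ a = ∅ := by
      ext x
      simp [stepR]
    rw [this, ih]

theorem seg_self {L : Type w} (α : ℕ → L) (n : ℕ) : seg α n n = [] := by
  simp [seg]

theorem seg_succ {L : Type w} (α : ℕ → L) {n m : ℕ} (h : n ≤ m) :
    seg α n (m + 1) = seg α n m ++ [α m] := by
  have e : m + 1 - n = (m - n) + 1 := by omega
  have e2 : n + (m - n) = m := by omega
  simp [seg, e, List.range_succ, e2]

theorem seg_append {L : Type w} (α : ℕ → L) {n m k : ℕ} (h : n ≤ m) (h' : m ≤ k) :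
    seg α n m ++ seg α m k = seg α n k := by
  induction k, h' using Nat.le_induction with
  | base => simp [seg_self]
  | succ k hk ih => rw [seg_succ α hk, seg_succ α (h.trans hk), ← ih, List.append_assoc]

theorem seg_isWord {V : Type u} {Ed : Type v} {L : Type w} (G : LabelledGraph V Ed L)
    {α : ℕ → L} (hα : G.IsInfWord α) (n m : ℕ) : G.IsWord (seg α n m) := by
  obtain ⟨p, hp, hl⟩ := hα
  refine ⟨seg p n m, ?_, ?_⟩
  · unfold IsPath List.Chain'
    rw [List.isChain_iff_getElem]
    intro i hi
    simp [seg]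
    exact hp _
  · simp [seg, Function.comp_def, hl]

theorem rFam_relRange {V : Type u} {Ed : Type v} {L : Type w} (G : LabelledGraph V Ed L)
    {ℬ : Set (Set V)} (hacc : G.Accommodating ℬ)
    {α : ℕ → L} (hα : G.IsInfWord α) {n m : ℕ} (h : n ≤ m) {A : Set V}
    (hA : A ∈ G.rFam ℬ (prefixN α n)) :
    G.relRange A (seg α n m) ∈ G.rFam ℬ (prefixN α m) := by
  refine ⟨hacc.1 _ hA.1 _ (G.seg_isWord hα n m), ?_⟩
  unfold prefixN range
  rw [← seg_append α (Nat.zero_le n) h, relRange_append]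
  exact G.relRange_mono hA.2 _

theorem adm_lift {V : Type u} {Ed : Type v} {L : Type w} (G : LabelledGraph V Ed L)
    {ℬ : Set (Set V)} {α : ℕ → L} {F : ℕ → Set (Set V)} (hF : G.Admissible ℬ α F)
    {n m k : ℕ} (h : n ≤ m) (h' : m ≤ k) {A : Set V}
    (hA : G.relRange A (seg α n m) ∈ F m) : G.relRange A (seg α n k) ∈ F k := by
  induction k, h' using Nat.le_induction with
  | base => exact hA
  | succ k hk ih =>
    rw [seg_succ α (h.trans hk), relRange_append]
    exact (hF.2 k ih).2

theorem fam_filter {V : Type u} {Ed : Type v} {L : Type w} (G : LabelledGraph V Ed L)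
    {ℬ : Set (Set V)} {α : ℕ → L} {F : ℕ → Set (Set V)} (hF : G.IsFam ℬ α F)
    {m : ℕ} {A : Set V} (hA : A ∈ F m) : IsFilterIn (G.rFam ℬ (prefixN α m)) (F m) := by
  rcases Nat.eq_zero_or_pos m with rfl | hm
  · rcases hF.2 with h | h
    · rw [h] at hA
      exact hA.elim
    · exact h
  · exact hF.1 m hm

/-- Completion of an admissible family: given an admissible family
`{F_n}` for `α ∈ 𝓛^∞(E)`, set
`F̄_n = {A ∈ ℬ_{α_{1,n}} : r(A, α_{n+1,m}) ∈ F_m for some m ≥ n}`. Then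
(i) `F_n ⊆ F̄_n` for every `n`; (ii) `{F̄_n}` is a complete family for `α`; and
(iii) `(α, {F_n})` and `(α, {F̄_n})` generate the same filter in `E(S)`. -/
theorem completion_of_admissible_family {V : Type u} {Ed : Type v} {L : Type w}
    [Nonempty V] [Countable V] [Nonempty Ed] [Countable Ed]
    (G : LabelledGraph V Ed L) (ℬ : Set (Set V))
    (hacc : G.Accommodating ℬ) (hwlr : G.WeaklyLeftResolving ℬ)
    (α : ℕ → L) (hα : G.IsInfWord α)
    (F : ℕ → Set (Set V)) (hF : G.Admissible ℬ α F)
    (Fbar : ℕ → Set (Set V))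
    (hFbar : Fbar = fun n =>
      {A ∈ G.rFam ℬ (prefixN α n) | ∃ m, n ≤ m ∧ G.relRange A (seg α n m) ∈ F m}) :
    (∀ n, F n ⊆ Fbar n) ∧
    G.Complete ℬ α Fbar ∧
    G.filtOfFam ℬ α F = G.filtOfFam ℬ α Fbar := by
  have hmem : ∀ n A, A ∈ Fbar n ↔ A ∈ G.rFam ℬ (prefixN α n) ∧
      ∃ m, n ≤ m ∧ G.relRange A (seg α n m) ∈ F m := by
    intro n A
    rw [hFbar]
    rfl
  clear hFbar
  have hsub : ∀ n, F n ⊆ Fbar n := by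
    intro n A hA
    refine (hmem n A).2 ⟨(hF.2 n hA).1, n, le_rfl, ?_⟩
    rw [seg_self]
    exact hA
  have hfilt : ∀ n, (Fbar n).Nonempty → IsFilterIn (G.rFam ℬ (prefixN α n)) (Fbar n) := by
    intro n hne
    refine ⟨hne, fun A hA => ((hmem n A).1 hA).1, ?_, ?_, ?_⟩
    · intro h0
      obtain ⟨-, m, hm, hFm⟩ := (hmem n ∅).1 h0
      have := (G.fam_filter hF.1 hFm).2.2.1
      rw [relRange_empty] at hFm
      exact this hFm
    · intro A hA B hB hAB
      obtain ⟨-, m, hm, hFm⟩ := (hmem n A).1 hA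
      exact (hmem n B).2 ⟨hB, m, hm, (G.fam_filter hF.1 hFm).2.2.2.1 _ hFm _
        (G.rFam_relRange hacc hα hm hB) (G.relRange_mono hAB _)⟩
    · intro A hA B hB
      obtain ⟨hA', m, hm, hFm⟩ := (hmem n A).1 hA
      obtain ⟨hB', k, hk, hFk⟩ := (hmem n B).1 hB
      have hAB : A ∩ B ∈ G.rFam ℬ (prefixN α n) :=
        ⟨hacc.2.1 _ hA'.1 _ hB'.1, Set.inter_subset_left.trans hA'.2⟩
      refine ⟨A ∩ B, ?_, Set.inter_subset_left, Set.inter_subset_right⟩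
      have h1 := G.adm_lift hF hm (le_max_left m k) hFm
      have h2 := G.adm_lift hF hk (le_max_right m k) hFk
      have hn : n ≤ max m k := hm.trans (le_max_left m k)
      have hfl := G.fam_filter hF.1 h1
      obtain ⟨C, hC, hCA, hCB⟩ := hfl.2.2.2.2 _ h1 _ h2
      refine (hmem n _).2 ⟨hAB, max m k, hn, ?_⟩
      refine hfl.2.2.2.1 C hC _ (G.rFam_relRange hacc hα hn hAB) ?_
      have hint : G.relRange (A ∩ B) (seg α n (max m k)) =
          G.relRange A (seg α n (max m k)) ∩ G.relRange B (seg α n (max m k)) := by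
        by_cases hw : seg α n (max m k) = []
        · rw [hw]
          rfl
        · exact hwlr _ hA'.1 _ hB'.1 _ hw
      rw [hint]
      exact Set.subset_inter hCA hCB
  refine ⟨hsub, ⟨⟨?_, ?_⟩, ?_⟩, ?_⟩
  · intro n hn
    exact hfilt n ((hF.1.1 n hn).1.mono (hsub n))
  · rcases Set.eq_empty_or_nonempty (Fbar 0) with h | h
    · exact Or.inl h
    · exact Or.inr (hfilt 0 h)
  · intro n
    have hone : seg α n (n + 1) = [α n] := by
      rw [seg_succ α le_rfl, seg_self]
      rfl
    ext A
    constructor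
    · intro hA
      obtain ⟨hA', m, hm, hFm⟩ := (hmem n A).1 hA
      refine ⟨hA', ?_⟩
      rw [← hone]
      refine (hmem _ _).2 ⟨G.rFam_relRange hacc hα (Nat.le_succ n) hA', max m (n + 1),
        le_max_right _ _, ?_⟩
      rw [← relRange_append, seg_append α (Nat.le_succ n) (le_max_right _ _)]
      exact G.adm_lift hF hm (le_max_left _ _) hFm
    · rintro ⟨hA', h⟩
      rw [← hone] at h
      obtain ⟨-, m, hm, hFm⟩ := (hmem _ _).1 h
      rw [← relRange_append, seg_append α (Nat.le_succ n) hm] at hFm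
      exact (hmem n A).2 ⟨hA', m, (Nat.le_succ n).trans hm, hFm⟩
  · ext q
    constructor
    · rintro ⟨hq, n, A, hA, hle⟩
      exact ⟨hq, n, A, hsub n hA, hle⟩
    · rintro ⟨hq, n, A, hA, γ, hγ, hAγ⟩
      obtain ⟨hA', m, hm, hFm⟩ := (hmem n A).1 hA
      refine ⟨hq, m, _, hFm, γ ++ seg α n m, ?_, ?_⟩
      · show prefixN α m = _
        rw [← List.append_assoc, ← hγ]
        exact (seg_append α (Nat.zero_le n) hm).symm
      · rw [relRange_append]
        exact G.relRange_mono hAγ _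

end LabelledGraph
end

section
/- Let (E, 𝓛, ℬ) be a weakly left resolving labelled space with associated inverse semigroup S, and let ξ^α and η^β be filters in E(S) with associated words α and β and associated families {ξ_n}_{0≤n≤|α|} and {η_n}_{0≤n≤|β|}. Then ξ^α ⊆ η^β if and only if α is a beginning of (or equal to) β and ξ_n ⊆ η_n for all 0 ≤ n ≤ |α|. -/
universe u v w

attribute [local instance] Classical.propDecidable

namespace LabelledGraph

theorem aux_length_prefixN {L : Type w} (α : ℕ → L) (n : ℕ) : (prefixN α n).length = n := by
  simp [prefixN, seg]

theorem aux_getElem_prefixN {L : Type w} (α : ℕ → L) (n i : ℕ) (h : i < n) :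
    (prefixN α n)[i]? = some (α i) := by
  simp [prefixN, seg, h]

theorem aux_take_prefixN {L : Type w} (α : ℕ → L) (n m : ℕ) (h : n ≤ m) :
    (prefixN α m).take n = prefixN α n := by
  simp [prefixN, seg, ← List.map_take, List.take_range, h]

/-- Beginnings have the same initial segments. -/
theorem aux_wTake_eq {L : Type w} (a b : List L ⊕ (ℕ → L)) (h : wBeg a b) (n : ℕ)
    (hn : wLe n a) : wTake a n = wTake b n := by
  rcases a with a | α <;> rcases b with b | β <;> simp only [wBeg, wLe, wTake] at *
  · obtain ⟨t, rfl⟩ := h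
    rw [List.take_append_of_le_length hn]
  · rw [h, aux_take_prefixN _ _ _ hn]
  · rw [h]

/-- Every word occurring in a filter is an initial segment of the word of the filter. -/
theorem aux_word {V : Type u} {Ed : Type v} {L : Type w} (G : LabelledGraph V Ed L)
    (ℬ : Set (Set V)) (ξ : Set (List L × Set V)) (hξ : G.IsFilterES ℬ ξ)
    (a : List L ⊕ (ℕ → L)) (ha : HasWord ξ a) (p : List L × Set V) (hp : p ∈ ξ) :
    wLe p.1.length a ∧ p.1 = wTake a p.1.length := by
  rcases a with a | α <;> simp only [HasWord, wLe, wTake] at *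
  · refine ⟨ha.2 p hp, ?_⟩
    obtain ⟨A, hA⟩ := ha.1
    obtain ⟨z, hz, ⟨γ, hγ, -⟩, ⟨δ, hδ, -⟩⟩ := hξ.2.2.2 _ hA p hp
    have h1 := ha.2 z hz
    simp only at hγ
    have h2 : γ = [] := by
      rw [hγ, List.length_append] at h1
      exact List.length_eq_zero_iff.mp (by omega)
    subst h2
    rw [List.append_nil] at hγ
    rw [← hγ, hδ, List.take_left]
  · refine ⟨trivial, ?_⟩
    obtain ⟨n, hn⟩ := ha.1 p hp
    rw [hn, aux_length_prefixN]

theorem aux_beg {V : Type u} {Ed : Type v} {L : Type w} (G : LabelledGraph V Ed L)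
    (ℬ : Set (Set V)) (ξ η : Set (List L × Set V)) (hη : G.IsFilterES ℬ η)
    (a b : List L ⊕ (ℕ → L)) (ha : HasWord ξ a) (hb : HasWord η b) (h : ξ ⊆ η) :
    wBeg a b := by
  have key := fun p hp => aux_word G ℬ η hη b hb p (h hp)
  rcases a with a | α <;> rcases b with b | β <;> simp only [wBeg, wLe, wTake, HasWord] at *
  · obtain ⟨A, hA⟩ := ha.1
    exact List.prefix_iff_eq_take.mpr (key _ hA).2
  · obtain ⟨A, hA⟩ := ha.1
    exact (key _ hA).2
  · obtain ⟨p, hp, hl⟩ := ha.2 (b.length + 1)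
    have := (key p hp).1
    omega
  · funext n
    obtain ⟨p, hp, hl⟩ := ha.2 (n + 1)
    obtain ⟨m, hm⟩ := ha.1 p hp
    have h2 := (key p hp).2
    have hl' : m = p.1.length := by rw [hm, aux_length_prefixN]
    have h3 : prefixN α p.1.length = prefixN β p.1.length := by rw [← h2, ← hl', ← hm]
    have h4 := congrArg (fun l => l[n]?) h3
    simp only [aux_getElem_prefixN _ _ _ hl] at h4
    exact Option.some.inj h4

/-- For filters `ξ = ξ^α` and `η = η^β` in `E(S)` with associated
(finite or infinite) words `α` and `β` and families `{ξ_n}`, `{η_n}`: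
`ξ ⊆ η` iff `α` is a beginning of (or equal to) `β` and `ξ_n ⊆ η_n` for all
`0 ≤ n ≤ |α|`. -/
theorem filter_inclusion_iff {V : Type u} {Ed : Type v} {L : Type w}
    [Nonempty V] [Countable V] [Nonempty Ed] [Countable Ed]
    (G : LabelledGraph V Ed L) (ℬ : Set (Set V))
    (hacc : G.Accommodating ℬ) (hwlr : G.WeaklyLeftResolving ℬ)
    (ξ η : Set (List L × Set V))
    (hξ : G.IsFilterES ℬ ξ) (hη : G.IsFilterES ℬ η)
    (wα wβ : List L ⊕ (ℕ → L)) (hgα : G.wGood wα) (hgβ : G.wGood wβ)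
    (hwα : HasWord ξ wα) (hwβ : HasWord η wβ) :
    ξ ⊆ η ↔
      (wBeg wα wβ ∧
        ∀ n, wLe n wα →
          {A : Set V | (wTake wα n, A) ∈ ξ} ⊆ {A : Set V | (wTake wβ n, A) ∈ η}) := by
  constructor
  · intro h
    have hb := aux_beg G ℬ ξ η hη wα wβ hwα hwβ h
    refine ⟨hb, fun n hn A hA => ?_⟩
    have hA' := h hA
    rw [aux_wTake_eq wα wβ hb n hn] at hA'
    exact hA'
  · rintro ⟨hb, hsub⟩ ⟨w, A⟩ hp
    obtain ⟨h1, h2⟩ := aux_word G ℬ ξ hξ wα hwα _ hp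
    simp only at h1 h2
    have h3 : A ∈ {A : Set V | (wTake wβ w.length, A) ∈ η} := by
      apply hsub _ h1
      change (_, A) ∈ ξ
      rw [← h2]
      exact hp
    change (_, A) ∈ η at h3
    rw [← aux_wTake_eq wα wβ hb _ h1, ← h2] at h3
    exact h3

end LabelledGraph
end
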